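/- Let (R, 𝔪) be a Henselian local ring and f = (f₁,…,fₙ) an n-tuple of polynomials in R[X₁,…,Xₙ] with f(0) = 0 and with Jacobian determinant e := J(0) ≠ 0 (not necessarily a unit). Then the map x ↦ f(x) restricted to e²·𝔪ⁿ := {e²m : m ∈ 𝔪ⁿ} is injective, and its image is contained in e·𝔪ⁿ; moreover for y = e²b with b ∈ 𝔪ⁿ in the image, the preimage is given by f⁻¹(y) = e·h⁻¹(N b), where N is the adjugate of the Jacobian matrix of f at 0 and h(X) := X + N g(X) with g(X) := f(X)/e linearized, i.e. f(eX) = e·M(0)·X + e² g(X). -/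

import Mathlib

open MvPolynomial in
theorem taylor_aux_const {R : Type*} [CommRing R] {n : ℕ} (I : Ideal R) (y : Fin n → R)
    (hy : ∀ i, y i ∈ I) (p : MvPolynomial (Fin n) R) :
    eval y p - eval (0 : Fin n → R) p ∈ I := by
  induction p using MvPolynomial.induction_on with
  | C a => simp
  | add p q hp hq =>
    have := I.add_mem hp hq
    simp only [map_add]
    convert this using 1
    ring
  | mul_X p k hp =>
    simp only [map_mul, eval_X, Pi.zero_apply, mul_zero, sub_zero]
    exact I.mul_mem_left _ (hy k)

open MvPolynomial in
theorem taylor_aux {R : Type*} [CommRing R] {n : ℕ} (I : Ideal R) (x y : Fin n → R)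
    (hx : ∀ i, x i ∈ I) (hy : ∀ i, y i ∈ I) (p : MvPolynomial (Fin n) R) :
    ∃ c : Fin n → R, (∀ j, c j ∈ I) ∧ eval x p - eval y p =
      ∑ j, (eval (0 : Fin n → R) (pderiv j p) + c j) * (x j - y j) := by
  induction p using MvPolynomial.induction_on with
  | C a => exact ⟨0, by simp, by simp⟩
  | add p q hp hq =>
    obtain ⟨c, hc, h1⟩ := hp
    obtain ⟨d, hd, h2⟩ := hq
    refine ⟨c + d, fun j => I.add_mem (hc j) (hd j), ?_⟩
    have : eval x (p + q) - eval y (p + q) =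
      (eval x p - eval y p) + (eval x q - eval y q) := by simp only [map_add]; ring
    rw [this, h1, h2, ← Finset.sum_add_distrib]
    refine Finset.sum_congr rfl fun j _ => ?_
    simp only [map_add, Pi.add_apply]
    ring
  | mul_X p k hp =>
    obtain ⟨c, hc, h1⟩ := hp
    refine ⟨fun j => (eval (0 : Fin n → R) (pderiv j p) + c j) * x k +
      (eval y p - eval (0 : Fin n → R) p) * (if j = k then 1 else 0), fun j => ?_, ?_⟩
    · exact I.add_mem (I.mul_mem_left _ (hx k))
        (I.mul_mem_right _ (taylor_aux_const I y hy p))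
    · have h3 : eval x (p * X k) - eval y (p * X k) =
        (eval x p - eval y p) * x k + eval y p * (x k - y k) := by
        simp only [map_mul, eval_X]; ring
      have h4 : eval y p * (x k - y k) =
          ∑ j, eval y p * (if j = k then 1 else 0) * (x j - y j) := by
        simp
      rw [h3, h1, h4, Finset.sum_mul, ← Finset.sum_add_distrib]
      refine Finset.sum_congr rfl fun j _ => ?_
      have h5 : eval (0 : Fin n → R) (pderiv j (p * X k)) =
          eval (0 : Fin n → R) p * (if j = k then 1 else 0) := by
        rw [Derivation.leibniz, pderiv_X]
        by_cases h : j = k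
        · subst h; simp
        · simp [h, Ne.symm h]
      rw [h5]
      ring

/-- Inverse mapping theorem over a Henselian local domain: if `f(0) = 0` and
`e := J(0) ≠ 0`, then `f` is injective on `e²·𝔪ⁿ`, maps it into `e·𝔪ⁿ`, and for
`y = e²b` the preimage is `e·h⁻¹(N·b)`, where `N` is the adjugate of the Jacobian
matrix at `0` and `h(X) = X + N·g(X)` with `f(eX) = e·M(0)·X + e²·g(X)`. -/
theorem henselian_inverse_mapping
    {R : Type*} [CommRing R] [IsDomain R] [HenselianLocalRing R]
    {n : ℕ} (f : Fin n → MvPolynomial (Fin n) R)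
    (hf0 : ∀ i, MvPolynomial.eval (0 : Fin n → R) (f i) = 0)
    (M : Matrix (Fin n) (Fin n) R)
    (hM : M = fun i j => MvPolynomial.eval (0 : Fin n → R) (MvPolynomial.pderiv j (f i)))
    (e : R) (he : e = M.det) (he0 : e ≠ 0)
    (N : Matrix (Fin n) (Fin n) R) (hN : N = M.adjugate)
    (g : Fin n → MvPolynomial (Fin n) R)
    (hg : ∀ i (x : Fin n → R),
      MvPolynomial.eval (fun j => e * x j) (f i)
        = e * (∑ j, M i j * x j) + e ^ 2 * MvPolynomial.eval x (g i)) :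
    -- injectivity on e²·𝔪ⁿ
    Set.InjOn (fun x (i : Fin n) => MvPolynomial.eval x (f i))
      {x : Fin n → R | ∀ i, ∃ m ∈ IsLocalRing.maximalIdeal R, x i = e ^ 2 * m} ∧
    -- image contained in e·𝔪ⁿ
    Set.MapsTo (fun x (i : Fin n) => MvPolynomial.eval x (f i))
      {x : Fin n → R | ∀ i, ∃ m ∈ IsLocalRing.maximalIdeal R, x i = e ^ 2 * m}
      {y : Fin n → R | ∀ i, ∃ m ∈ IsLocalRing.maximalIdeal R, y i = e * m} ∧
    -- preimage formula: for y = e²·b, f(e·x) = y iff h(x) = N·b, i.e. f⁻¹(y) = e·h⁻¹(N·b)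
    ∀ b : Fin n → R, (∀ i, b i ∈ IsLocalRing.maximalIdeal R) →
      ∀ x : Fin n → R, (∀ i, x i ∈ IsLocalRing.maximalIdeal R) →
        ((∀ i, MvPolynomial.eval (fun j => e * x j) (f i) = e ^ 2 * b i) ↔
          (∀ i, x i + ∑ j, N i j * MvPolynomial.eval x (g j) = ∑ j, N i j * b j)) := by
  have hNM : N * M = e • (1 : Matrix (Fin n) (Fin n) R) := by
    rw [hN, he, Matrix.adjugate_mul]
  have hMN : M * N = e • (1 : Matrix (Fin n) (Fin n) R) := by
    rw [hN, he, Matrix.mul_adjugate]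
  set I : Ideal R := Ideal.span {e ^ 2} * IsLocalRing.maximalIdeal R with hI
  have hmem : ∀ z, z ∈ I ↔ ∃ m ∈ IsLocalRing.maximalIdeal R, z = e ^ 2 * m := by
    intro z
    rw [hI, Ideal.mem_span_singleton_mul]
    simp only [eq_comm]
  refine ⟨?_, ?_, ?_⟩
  · intro x hx y hy hxy
    have hx' : ∀ i, x i ∈ I := fun i => (hmem _).2 (hx i)
    have hy' : ∀ i, y i ∈ I := fun i => (hmem _).2 (hy i)
    choose c hc hfc using fun i => taylor_aux I x y hx' hy' (f i)
    choose B hB hcB using fun i j => (hmem _).1 (hc i j)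
    have h0 : (M + e ^ 2 • Matrix.of B).mulVec (x - y) = 0 := by
      funext i
      have h1 := hfc i
      have h2 : MvPolynomial.eval x (f i) = MvPolynomial.eval y (f i) := congrFun hxy i
      rw [h2, sub_self] at h1
      simp only [Matrix.mulVec, dotProduct, Matrix.add_apply, Matrix.smul_apply, Matrix.of_apply,
        smul_eq_mul, Pi.sub_apply, Pi.zero_apply]
      rw [h1, hM]
      exact Finset.sum_congr rfl fun j _ => by rw [hcB]
    have h1 : N * (M + e ^ 2 • Matrix.of B) = e • (1 + e • (N * Matrix.of B)) := by
      rw [mul_add, hNM, Matrix.mul_smul, smul_add, smul_smul, pow_two]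
    have h2 : e • (1 + e • (N * Matrix.of B)).mulVec (x - y) = 0 := by
      rw [← Matrix.smul_mulVec, ← h1, ← Matrix.mulVec_mulVec, h0, Matrix.mulVec_zero]
    have h3 := (smul_eq_zero.1 h2).resolve_left he0
    have hdet : (1 + e • (N * Matrix.of B)).det ≠ 0 := by
      intro h
      have h4 := congrArg (IsLocalRing.residue R) h
      rw [RingHom.map_det, map_zero] at h4
      have h5 : (IsLocalRing.residue R).mapMatrix (1 + e • (N * Matrix.of B)) = 1 := by
        have : (IsLocalRing.residue R).mapMatrix (Matrix.of B) = 0 := by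
          ext i j
          simpa [IsLocalRing.residue_eq_zero_iff] using hB i j
        rw [← Matrix.smul_mul]
        rw [map_add, map_mul, this, mul_zero, add_zero, map_one]
      rw [h5, Matrix.det_one] at h4
      exact one_ne_zero h4
    exact sub_eq_zero.1 (Matrix.eq_zero_of_mulVec_eq_zero hdet h3)
  · intro x hx i
    have hx' : ∀ i, x i ∈ I := fun i => (hmem _).2 (hx i)
    have h := taylor_aux_const I x hx' (f i)
    rw [hf0, sub_zero] at h
    obtain ⟨m, hm, h⟩ := (hmem _).1 h
    exact ⟨e * m, Ideal.mul_mem_left _ _ hm, by simp only [h]; ring⟩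
  · intro b _ x _
    set G : Fin n → R := fun i => MvPolynomial.eval x (g i) with hG
    have hL : (∀ i, MvPolynomial.eval (fun j => e * x j) (f i) = e ^ 2 * b i) ↔
        M.mulVec x + e • G = e • b := by
      rw [funext_iff]
      refine forall_congr' fun i => ?_
      rw [hg]
      simp only [Matrix.mulVec, dotProduct, Pi.add_apply, Pi.smul_apply, smul_eq_mul, hG]
      constructor
      · intro h
        apply mul_left_cancel₀ he0
        linear_combination h
      · intro h
        linear_combination e * h
    have hR : (∀ i, x i + ∑ j, N i j * MvPolynomial.eval x (g j) = ∑ j, N i j * b j) ↔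
        x + N.mulVec G = N.mulVec b := by
      rw [funext_iff]
      rfl
    rw [hL, hR]
    constructor
    · intro h
      have h1 := congrArg N.mulVec h
      rw [Matrix.mulVec_add, Matrix.mulVec_mulVec, hNM, Matrix.mulVec_smul, Matrix.mulVec_smul,
        Matrix.smul_mulVec, Matrix.one_mulVec, ← smul_add] at h1
      exact smul_right_injective _ he0 h1
    · intro h
      have h1 := congrArg M.mulVec h
      rwa [Matrix.mulVec_add, Matrix.mulVec_mulVec, Matrix.mulVec_mulVec, hMN,
        Matrix.smul_mulVec, Matrix.smul_mulVec, Matrix.one_mulVec, Matrix.one_mulVec] at h1
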